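/- Let k be a field, let A be an essentially small hereditary abelian k-linear category with finite-dimensional Hom and Ext^1 spaces, and let T be a tilting object of A with associated torsion pair (T, F). Then for every Z/2-graded complex M over A there exists a short exact sequence 0 → M →(f_1) X →(f_2) T_2 → 0 in C_{Z/2}(A) such that f_1 is a quasi-isomorphism, both components of X lie in T, and both components of T_2 lie in add T (in particular T_2 is acyclic). -/

import Mathlib

open CategoryTheory CategoryTheory.Limits ZeroObject

universe w₁ w₂ w' v u

noncomputable section

/-- The complex shape indexing `ℤ/2`-graded complexes: the differential goes from
degree `i` to degree `i + 1` (indices taken modulo `2`). -/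
abbrev Z2Shape : ComplexShape (ZMod 2) := ComplexShape.up' 1

/-- The abelian category `C_{ℤ/2}(𝒜)` of `ℤ/2`-graded complexes over `𝒜`. -/
abbrev CZ2 (𝒜 : Type u) [Category.{v} 𝒜] [Abelian 𝒜] := HomologicalComplex 𝒜 Z2Shape

variable {𝒜 : Type u} [Category.{v} 𝒜] [Abelian 𝒜]

/-- A `ℤ/2`-graded complex is acyclic if all of its homology objects (`H⁰` and `H¹`) vanish. -/
def AcyclicZ2 {𝒜 : Type u} [Category.{v} 𝒜] [Abelian 𝒜] (M : CZ2 𝒜) : Prop :=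
  ∀ i, IsZero (M.homology i)

/-- `f : X ⟶ Y` and `g : Y ⟶ Z` form a short exact sequence `0 ⟶ X ⟶ Y ⟶ Z ⟶ 0`. -/
def IsShortExactSeq {C : Type*} [Category C] [Limits.HasZeroMorphisms C]
    {X Y Z : C} (f : X ⟶ Y) (g : Y ⟶ Z) : Prop :=
  ∃ w : f ≫ g = 0, (ShortComplex.mk f g w).ShortExact

/-- An abelian category is hereditary if `Ext^p(X, Y) = 0` for all objects `X`, `Y`
and all `p ≥ 2`. -/
def Hereditary (𝒜 : Type u) [Category.{v} 𝒜] [Abelian 𝒜] [HasExt.{w₁} 𝒜] : Prop :=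
  ∀ (X Y : 𝒜) (p : ℕ), 2 ≤ p → Subsingleton (Abelian.Ext X Y p)

/-- `X` belongs to `add T`: it is a direct summand of a finite direct sum of copies of `T`. -/
def InAdd {𝒜 : Type u} [Category.{v} 𝒜] [Abelian 𝒜] (T X : 𝒜) : Prop :=
  haveI : HasFiniteBiproducts 𝒜 := HasFiniteBiproducts.of_hasFiniteProducts
  ∃ (n : ℕ) (Y : 𝒜), Nonempty ((X ⊞ Y) ≅ ⨁ (fun _ : Fin n => T))

/-- `(𝒯, ℱ)` is a torsion pair in the abelian category `𝒜`. -/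
structure IsTorsionPair {𝒜 : Type u} [Category.{v} 𝒜] [Abelian 𝒜]
    (𝒯 ℱ : 𝒜 → Prop) : Prop where
  hom_zero : ∀ {X Y : 𝒜}, 𝒯 X → ℱ Y → ∀ f : X ⟶ Y, f = 0
  decomp : ∀ X : 𝒜, ∃ (TX FX : 𝒜) (i : TX ⟶ X) (p : X ⟶ FX),
      𝒯 TX ∧ ℱ FX ∧ IsShortExactSeq i p

/-- `T` is a tilting object of `𝒜` with associated torsion pair `(𝒯, ℱ)`:
(i) the torsion class `𝒯` cogenerates `𝒜`; (ii) `𝒯 = Fac T`; (iii) `T` is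
Ext-projective in `𝒯`; (iv) any `Z ∈ 𝒯` which is Ext-projective in `𝒯` lies in
`add T`; (v) if `Ext^i(T, X) = 0` for all `i ≥ 0` then `X = 0`. -/
structure IsTilting {𝒜 : Type u} [Category.{v} 𝒜] [Abelian 𝒜] [HasExt.{w₁} 𝒜]
    (T : 𝒜) (𝒯 ℱ : 𝒜 → Prop) : Prop where
  torsionPair : IsTorsionPair 𝒯 ℱ
  cogenerates : ∀ X : 𝒜, ∃ (TX : 𝒜) (f : X ⟶ TX), 𝒯 TX ∧ Mono f
  torsion_eq_fac : ∀ X : 𝒜, 𝒯 X ↔ ∃ (Z : 𝒜) (p : Z ⟶ X), InAdd T Z ∧ Epi p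
  ext_vanishing : ∀ X : 𝒜, 𝒯 X → ∀ i : ℕ, 0 < i → Subsingleton (Abelian.Ext T X i)
  ext_projective_in_add : ∀ Z : 𝒜, 𝒯 Z →
      (∀ X : 𝒜, 𝒯 X → ∀ i : ℕ, 0 < i → Subsingleton (Abelian.Ext Z X i)) → InAdd T Z
  nondegenerate : ∀ X : 𝒜, (∀ i : ℕ, Subsingleton (Abelian.Ext T X i)) → IsZero X

attribute [local instance] CategoryTheory.Abelian.hasFiniteBiproducts

namespace CZ2

/-- The contractible `ℤ/2`-graded complex with components `N ⊞ N`, whose differential maps the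
first summand identically onto the second one. -/
abbrev disk (N : 𝒜) : CZ2 𝒜 where
  X _ := N ⊞ N
  d i j := if i + 1 = j then biprod.fst ≫ biprod.inr else 0
  shape i j h := if_neg h
  d_comp_d' i j l _ _ := by split_ifs <;> simp

lemma rel_succ (i : ZMod 2) : Z2Shape.Rel i (i + 1) := rfl

lemma rel_pred (i : ZMod 2) : Z2Shape.Rel (i + 1) i := by
  change i + 1 + 1 = i
  revert i
  decide

lemma disk_d_of_rel (N : 𝒜) {i j : ZMod 2} (h : Z2Shape.Rel i j) :
    (disk N).d i j = biprod.fst ≫ biprod.inr := if_pos h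

lemma eq_succ_of_rel {i j : ZMod 2} (h : Z2Shape.Rel i j) : i = j + 1 := by
  change i + 1 = j at h
  subst h
  revert i
  decide

/-- The identity of `disk N` is null-homotopic. -/
def diskHomotopy (N : 𝒜) : Homotopy (𝟙 (disk N)) 0 where
  hom i j := if j + 1 = i then biprod.snd ≫ biprod.inl else 0
  zero i j h := if_neg h
  comm i := by
    rw [dNext_eq _ (rel_succ i), prevD_eq _ (rel_pred i), disk_d_of_rel _ (rel_succ i),
      disk_d_of_rel _ (rel_pred i), if_pos rfl, if_pos (show i + 1 + 1 = i from rel_pred i)]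
    apply biprod.hom_ext' <;> simp

lemma acyclicZ2_disk (N : 𝒜) : AcyclicZ2 (disk N) := fun i => by
  rw [IsZero.iff_id_eq_zero, ← HomologicalComplex.homologyMap_id,
    (diskHomotopy N).homologyMap_eq i, HomologicalComplex.homologyMap_zero]

/-- A family of morphisms `N ⟶ Q.X i` induces a morphism `disk N ⟶ Q`. -/
@[simps]
def diskDesc {N : 𝒜} {Q : CZ2 𝒜} (g : ∀ i, N ⟶ Q.X i) : disk N ⟶ Q where
  f i := biprod.desc (g i) (g (i + 1) ≫ Q.d (i + 1) i)
  comm' i j h := by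
    rw [disk_d_of_rel _ h, eq_succ_of_rel h]
    apply biprod.hom_ext' <;> simp

/-- A family of morphisms `M.X i ⟶ J` induces a morphism `M ⟶ disk J`. -/
@[simps]
def diskLift {M : CZ2 𝒜} {J : 𝒜} (e : ∀ i, M.X i ⟶ J) : M ⟶ disk J where
  f i := biprod.lift (M.d i (i + 1) ≫ e (i + 1)) (e i)
  comm' i j h := by
    rw [disk_d_of_rel _ h]
    obtain rfl : i + 1 = j := h
    apply biprod.hom_ext <;> simp

lemma mono_diskLift {M : CZ2 𝒜} {J : 𝒜} (e : ∀ i, M.X i ⟶ J) [∀ i, Mono (e i)] :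
    Mono (diskLift e) :=
  HomologicalComplex.mono_of_mono_f _ fun i =>
    mono_of_mono_fac (biprod.lift_snd (M.d i (i + 1) ≫ e (i + 1)) (e i))

lemma quasiIso_of_acyclicZ2 {S : ShortComplex (CZ2 𝒜)} (hS : S.ShortExact)
    (h : AcyclicZ2 S.X₃) : QuasiIso S.f where
  quasiIsoAt i := by
    rw [quasiIsoAt_iff_isIso_homologyMap]
    have : Mono (HomologicalComplex.homologyMap S.f i) :=
      (hS.homology_exact₁ (i + 1) i (rel_pred i)).mono_g ((h _).eq_of_src _ _)
    have : Epi (HomologicalComplex.homologyMap S.f i) :=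
      (hS.homology_exact₂ i).epi_f ((h _).eq_of_tgt _ _)
    exact isIso_of_mono_of_epi _

end CZ2

lemma CategoryTheory.ShortComplex.ShortExact.mono_pullback_lift {C : Type*} [Category* C]
    [Abelian C] {S : ShortComplex C} (hS : S.ShortExact) {P : C} (p : P ⟶ S.X₃) :
    Mono (pullback.lift S.f 0 (by simp) : S.X₁ ⟶ pullback S.g p) := by
  have := hS.mono_f
  exact mono_of_mono_fac (pullback.lift_fst S.f 0 (by simp))

/-- Pulling back a short exact sequence along a morphism to its right-hand term gives a short
exact sequence. -/
lemma CategoryTheory.ShortComplex.ShortExact.pullback {C : Type*} [Category* C] [Abelian C]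
    {S : ShortComplex C} (hS : S.ShortExact) {P : C} (p : P ⟶ S.X₃) :
    (ShortComplex.mk (pullback.lift S.f 0 (by simp) : S.X₁ ⟶ pullback S.g p)
      (pullback.snd S.g p) (pullback.lift_snd _ _ _)).ShortExact where
  exact := by
    have := hS.mono_f
    have := hS.mono_pullback_lift p
    refine ShortComplex.exact_of_f_is_kernel _ (KernelFork.IsLimit.ofι' (hi := this) _ _
      fun {W} a ha => ?_)
    have w : (a ≫ pullback.fst S.g p) ≫ S.g = 0 := by
      rw [Category.assoc, pullback.condition, reassoc_of% ha, zero_comp]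
    refine ⟨hS.exact.lift _ w, ?_⟩
    apply pullback.hom_ext
    · exact (Category.assoc _ _ _).trans
        ((whisker_eq _ (pullback.lift_fst _ _ _)).trans (hS.exact.lift_f _ w))
    · exact (Category.assoc _ _ _).trans
        ((whisker_eq _ (pullback.lift_snd _ _ _)).trans (comp_zero.trans ha.symm))
  mono_f := hS.mono_pullback_lift p
  epi_g := by
    have := hS.epi_g
    dsimp
    infer_instance

section Ext

variable [HasExt.{w₁} 𝒜]

open Abelian

lemma CategoryTheory.Abelian.Ext.subsingleton_X₂ {S : ShortComplex 𝒜} (hS : S.ShortExact)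
    (T : 𝒜) (n : ℕ) [Subsingleton (Ext T S.X₁ n)] [Subsingleton (Ext T S.X₃ n)] :
    Subsingleton (Ext T S.X₂ n) :=
  subsingleton_of_forall_eq 0 fun x => by
    obtain ⟨y, rfl⟩ := Ext.covariant_sequence_exact₂ T hS x (Subsingleton.elim _ _)
    rw [Subsingleton.elim y 0, Ext.zero_comp]

lemma CategoryTheory.Abelian.Ext.subsingleton_biprod (T X Y : 𝒜) (n : ℕ)
    [Subsingleton (Ext T X n)] [Subsingleton (Ext T Y n)] : Subsingleton (Ext T (X ⊞ Y) n) :=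
  Ext.subsingleton_X₂
    (ShortComplex.Splitting.shortExact (S := ShortComplex.mk (biprod.inl : X ⟶ X ⊞ Y)
      (biprod.snd : X ⊞ Y ⟶ Y) (by simp))
      { r := biprod.fst, s := biprod.inr }) T n

lemma CategoryTheory.Abelian.Ext.subsingleton_X₁ {S : ShortComplex 𝒜} (hS : S.ShortExact)
    (T : 𝒜) (hsurj : ∀ f : T ⟶ S.X₃, ∃ g : T ⟶ S.X₂, g ≫ S.g = f)
    [Subsingleton (Ext T S.X₂ 1)] : Subsingleton (Ext T S.X₁ 1) :=
  subsingleton_of_forall_eq 0 fun x => by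
    obtain ⟨y, rfl⟩ :=
      Ext.covariant_sequence_exact₁ T hS x (Subsingleton.elim _ _) (zero_add 1)
    obtain ⟨f, rfl⟩ := Ext.mk₀_bijective _ _ |>.2 y
    obtain ⟨g, rfl⟩ := hsurj f
    rw [← Ext.mk₀_comp_mk₀, Ext.comp_assoc_of_second_deg_zero, hS.comp_extClass, Ext.comp_zero]

end Ext

/-- A direct sum of two copies of a power of `T` lies in `add T`. -/
lemma inAdd_biprod_biproduct (T : 𝒜) (n : ℕ) :
    InAdd T ((⨁ fun _ : Fin n => T) ⊞ ⨁ fun _ : Fin n => T) := by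
  let e : ((⨁ fun _ : Fin n => T) ⊞ ⨁ fun _ : Fin n => T) ≅ ⨁ fun _ : Fin n ⊕ Fin n => T :=
    { hom := biproduct.lift fun s => s.elim (fun j => biprod.fst ≫ biproduct.π _ j)
        (fun j => biprod.snd ≫ biproduct.π _ j)
      inv := biprod.lift (biproduct.lift fun j => biproduct.π _ (Sum.inl j))
        (biproduct.lift fun j => biproduct.π _ (Sum.inr j))
      hom_inv_id := by
        apply biprod.hom_ext <;> apply biproduct.hom_ext <;> intro j <;> simp
      inv_hom_id := by
        apply biproduct.hom_ext
        rintro (j | j) <;> simp }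
  exact ⟨n + n, 0, ⟨(isoBiprodZero (isZero_zero 𝒜)).symm ≪≫ e ≪≫
    biproduct.whiskerEquiv finSumFinEquiv fun _ => Iso.refl T⟩⟩

lemma exists_fin_of_inAdd {T Z : 𝒜} (h : InAdd T Z) :
    ∃ (n : ℕ) (p : (⨁ fun _ : Fin n => T) ⟶ Z), Epi p := by
  obtain ⟨n, Y, ⟨e⟩⟩ := h
  exact ⟨n, e.inv ≫ biprod.fst, inferInstance⟩

lemma inAdd_self (T : 𝒜) : InAdd T T :=
  ⟨1, 0, ⟨(isoBiprodZero (isZero_zero 𝒜)).symm ≪≫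
    (biproductUniqueIso fun _ : Fin 1 => T).symm⟩⟩

namespace IsTilting

open Abelian

variable [HasExt.{w₁} 𝒜] {T : 𝒜} {𝒯 ℱ : 𝒜 → Prop}

lemma torsion_of_inAdd (hT : IsTilting T 𝒯 ℱ) {X : 𝒜} (h : InAdd T X) : 𝒯 X :=
  (hT.torsion_eq_fac X).2 ⟨X, 𝟙 X, h, inferInstance⟩

lemma torsion_of_epi (hT : IsTilting T 𝒯 ℱ) {X Y : 𝒜} (hX : 𝒯 X) (p : X ⟶ Y) [Epi p] : 𝒯 Y := by
  obtain ⟨Z, q, hZ, _⟩ := (hT.torsion_eq_fac X).1 hX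
  exact (hT.torsion_eq_fac Y).2 ⟨Z, q ≫ p, hZ, inferInstance⟩

/-- In a hereditary category, the torsion class of a tilting object `T` is the kernel of
`Ext¹(T, -)`. -/
lemma torsion_iff_subsingleton_ext (hT : IsTilting T 𝒯 ℱ) (h𝒜 : Hereditary 𝒜) (X : 𝒜) :
    𝒯 X ↔ Subsingleton (Ext T X 1) := by
  refine ⟨fun h => hT.ext_vanishing X h 1 one_pos, fun h => ?_⟩
  obtain ⟨t, f, i, p, ht, hf, w, hS⟩ := hT.torsionPair.decomp X
  have hf0 : IsZero f := by
    refine hT.nondegenerate f fun n => ?_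
    match n with
    | 0 =>
      refine subsingleton_of_forall_eq 0 fun x => ?_
      obtain ⟨g, rfl⟩ := (Ext.mk₀_bijective _ _).2 x
      rw [hT.torsionPair.hom_zero (hT.torsion_of_inAdd (inAdd_self T)) hf g, Ext.mk₀_zero]
    | 1 =>
      have := h𝒜 T t 2 le_rfl
      refine subsingleton_of_forall_eq 0 fun x => ?_
      obtain ⟨y, rfl⟩ := Ext.covariant_sequence_exact₃ T hS x (one_add_one_eq_two)
        (Subsingleton.elim _ _)
      rw [Subsingleton.elim y 0, Ext.zero_comp]
    | n + 2 => exact h𝒜 T f (n + 2) (by lia)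
  have : Epi i := hS.exact.epi_f (hf0.eq_of_tgt _ _)
  exact hT.torsion_of_epi ht i

lemma torsion_biprod (hT : IsTilting T 𝒯 ℱ) (h𝒜 : Hereditary 𝒜) {X Y : 𝒜} (hX : 𝒯 X)
    (hY : 𝒯 Y) : 𝒯 (X ⊞ Y) := by
  rw [hT.torsion_iff_subsingleton_ext h𝒜] at *
  exact Ext.subsingleton_biprod T X Y 1

/-- A pullback of objects of the torsion class lies in the torsion class as soon as every
morphism from `T` to the base lifts along `p`, and `p` is epi. -/
lemma torsion_of_isPullback (hT : IsTilting T 𝒯 ℱ) (h𝒜 : Hereditary 𝒜) {X Y P Q : 𝒜}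
    {a : X ⟶ Y} {b : X ⟶ P} {q : Y ⟶ Q} {p : P ⟶ Q} (sq : IsPullback a b q p)
    (hY : 𝒯 Y) (hP : 𝒯 P) [Epi p] (hp : ∀ f : T ⟶ Q, ∃ g : T ⟶ P, g ≫ p = f) : 𝒯 X := by
  have : Subsingleton (Ext T sq.shortComplex'.X₂ 1) :=
    (hT.torsion_iff_subsingleton_ext h𝒜 _).1 (hT.torsion_biprod h𝒜 hY hP)
  have hS : sq.shortComplex'.ShortExact :=
    { exact := sq.exact_shortComplex'
      mono_f := sq.mono_shortComplex'_f
      epi_g := by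
        have w : (-biprod.inr : P ⟶ Y ⊞ P) ≫ sq.shortComplex'.g = p := by
          simp [CommSq.shortComplex']
        exact @epi_of_epi_fac _ _ _ _ _ _ _ _ ‹Epi p› w }
  refine (hT.torsion_iff_subsingleton_ext h𝒜 _).2 (Ext.subsingleton_X₁ hS T fun f => ?_)
  obtain ⟨g, rfl⟩ := hp f
  exact ⟨g ≫ (-biprod.inr), by simp [CommSq.shortComplex']⟩

end IsTilting

/-- A finite family of objects `Q i` with finite-dimensional `Hom`-spaces from `T` admits a
common power of `T` through which all morphisms `T ⟶ Q i` factor. -/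
lemma exists_approximation (k : Type w') [Field k] [CategoryTheory.Linear k 𝒜]
    [∀ X Y : 𝒜, FiniteDimensional k (X ⟶ Y)] {ι : Type*} [Finite ι] (T : 𝒜) (Q : ι → 𝒜) :
    ∃ (n : ℕ) (g : ∀ i, (⨁ fun _ : Fin n => T) ⟶ Q i),
      ∀ i (f : T ⟶ Q i), ∃ l, l ≫ g i = f := by
  classical
  let b := Module.finBasis k (∀ i, T ⟶ Q i)
  refine ⟨_, fun i => biproduct.desc fun j => b j i, fun i f => ?_⟩
  refine ⟨biproduct.lift fun j => b.repr (Pi.single i f) j • 𝟙 T, ?_⟩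
  have := congr_fun (b.sum_repr (Pi.single i f)) i
  simpa [biproduct.lift_desc] using this

lemma epi_of_factors {T Z Q P : 𝒜} (hZ : InAdd T Z) (q : Z ⟶ Q) [Epi q] (p : P ⟶ Q)
    (hp : ∀ f : T ⟶ Q, ∃ l, l ≫ p = f) : Epi p := by
  obtain ⟨n, r, _⟩ := exists_fin_of_inAdd hZ
  choose l hl using fun j : Fin n => hp (biproduct.ι (fun _ => T) j ≫ r ≫ q)
  have : biproduct.desc l ≫ p = r ≫ q := biproduct.hom_ext' _ _ fun j => by simp [hl]
  exact epi_of_epi_fac this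

/-- if `T` is a tilting object in a hereditary abelian category with torsion
pair `(𝒯, ℱ)`, every `ℤ/2`-graded complex `M` admits a short exact sequence
`0 → M → X → T₂ → 0` in `C_{ℤ/2}(𝒜)` with `M → X` a quasi-isomorphism, both components
of `X` in `𝒯`, and both components of `T₂` in `add T` (in particular `T₂` is acyclic). -/
theorem stmt17 (k : Type w') [Field k] {𝒜 : Type u} [Category.{v} 𝒜] [Abelian 𝒜]
    [CategoryTheory.Linear k 𝒜] [EssentiallySmall.{w₂} 𝒜] [HasExt.{w₁} 𝒜]
    [∀ X Y : 𝒜, FiniteDimensional k (X ⟶ Y)]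
    (hExtFin : ∀ X Y : 𝒜, ∃ n : ℕ, Nonempty (Abelian.Ext X Y 1 ≃+ (Fin n → k)))
    (h𝒜 : Hereditary 𝒜) (T : 𝒜) {𝒯 ℱ : 𝒜 → Prop} (hT : IsTilting T 𝒯 ℱ) :
    ∀ M : CZ2 𝒜, ∃ (X T₂ : CZ2 𝒜) (f₁ : M ⟶ X) (f₂ : X ⟶ T₂),
      IsShortExactSeq f₁ f₂ ∧ QuasiIso f₁ ∧
      (∀ i, 𝒯 (X.X i)) ∧ (∀ i, InAdd T (T₂.X i)) ∧ AcyclicZ2 T₂ := by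
  intro M
  obtain ⟨J, m, hJ, _⟩ := hT.cogenerates (⨁ M.X)
  let e : M ⟶ CZ2.disk J := CZ2.diskLift fun i => biproduct.ι M.X i ≫ m
  have : Mono e := CZ2.mono_diskLift _
  have hS : (ShortComplex.mk e (cokernel.π e) (cokernel.condition e)).ShortExact :=
    { exact := ShortComplex.exact_cokernel e }
  obtain ⟨n, g, hg⟩ := exists_approximation k T (cokernel e).X
  let p : CZ2.disk (⨁ fun _ : Fin n => T) ⟶ cokernel e := CZ2.diskDesc g
  have hp : ∀ i (f : T ⟶ (cokernel e).X i), ∃ l, l ≫ p.f i = f := fun i f => by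
    obtain ⟨l, rfl⟩ := hg i f
    exact ⟨l ≫ biprod.inl, by simp [p]⟩
  have hY : ∀ i, 𝒯 ((CZ2.disk J).X i) := fun _ => hT.torsion_biprod h𝒜 hJ hJ
  have hadd : ∀ i, InAdd T ((CZ2.disk (⨁ fun _ : Fin n => T)).X i) :=
    fun _ => inAdd_biprod_biproduct T n
  have hepi : ∀ i, Epi (p.f i) := fun i => by
    obtain ⟨Z, q, hZ, _⟩ :=
      (hT.torsion_eq_fac _).1 (hT.torsion_of_epi (hY i) ((cokernel.π e).f i))
    exact epi_of_factors hZ q _ (hp i)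
  refine ⟨_, _, _, _, ⟨_, hS.pullback p⟩,
    CZ2.quasiIso_of_acyclicZ2 (hS.pullback p) (CZ2.acyclicZ2_disk _), fun i => ?_, hadd,
    CZ2.acyclicZ2_disk _⟩
  exact hT.torsion_of_isPullback h𝒜
    ((IsPullback.of_hasPullback (cokernel.π e) p).map (HomologicalComplex.eval 𝒜 Z2Shape i))
    (p := p.f i) (hY i) (hT.torsion_of_inAdd (hadd i)) (hp i)

end
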